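/- arXiv:2102.07177 — 4 statements merged into one kernel-verified Lean document; each statement's English description precedes it below -/
import Mathlib

section
/- Let V be a finite-dimensional real vector space, E ⊆ V a subspace, and ε an alternating bilinear form on E. Then the subspace L(E,ε) = {(u,α) ∈ V × V* : u ∈ E and α(e) = ε(u,e) for all e ∈ E} of V × V* is isotropic for the canonical pairing, has dimension equal to dim V, and is maximal isotropic: every isotropic subspace of V × V* containing L(E,ε) equals L(E,ε). -/
/-- Let `V` be a finite-dimensional real vector space, `E ⊆ V` a subspace, and `ε` an
alternating bilinear form on `E`.  Then the subspace
`L(E,ε) = {(u,α) ∈ V × V* : u ∈ E and α(e) = ε(u,e) for all e ∈ E}` of `V × V*` is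
isotropic for the canonical pairing, has dimension equal to `dim V`, and is maximal
isotropic. -/
theorem stmt_1 (V : Type*) [AddCommGroup V] [Module ℝ V] [FiniteDimensional ℝ V]
    (pairing : (V × Module.Dual ℝ V) → (V × Module.Dual ℝ V) → ℝ)
    (hpair : ∀ x y, pairing x y = x.2 y.1 + y.2 x.1)
    (E : Submodule ℝ V) (ε : E →ₗ[ℝ] E →ₗ[ℝ] ℝ)
    (hε : ∀ u : E, ε u u = 0)
    (L : Submodule ℝ (V × Module.Dual ℝ V))
    (hL : ∀ p : V × Module.Dual ℝ V,
      p ∈ L ↔ ∃ h : p.1 ∈ E, ∀ e : E, p.2 e.1 = ε ⟨p.1, h⟩ e) :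
    (∀ x ∈ L, ∀ y ∈ L, pairing x y = 0) ∧
    Module.finrank ℝ L = Module.finrank ℝ V ∧
    (∀ L' : Submodule ℝ (V × Module.Dual ℝ V),
      (∀ x ∈ L', ∀ y ∈ L', pairing x y = 0) → L ≤ L' → L' = L) := by
  have halt : ε.IsAlt := hε
  obtain ⟨π, hπ⟩ := E.subtype.exists_leftInverse_of_injective E.ker_subtype
  replace hπ (e : E) : π e = e := LinearMap.congr_fun hπ e
  have lift_mem (u : E) (β : E.dualAnnihilator) : ((u : V), (ε u).comp π + β.1) ∈ L := by
    refine (hL _).2 ⟨u.2, fun e => ?_⟩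
    have hβ : β.1 (e : V) = 0 := (Submodule.mem_dualAnnihilator _).1 β.2 e e.2
    simp [hπ, hβ]
  refine ⟨fun x hx y hy => ?_, ?_, fun L' hL' hle => le_antisymm (fun p hp => ?_) hle⟩
  · obtain ⟨hx1, hx2⟩ := (hL x).1 hx
    obtain ⟨hy1, hy2⟩ := (hL y).1 hy
    rw [hpair, hx2 ⟨y.1, hy1⟩, hy2 ⟨x.1, hx1⟩, ← halt.neg ⟨y.1, hy1⟩, neg_add_cancel]
  · let f : (E × E.dualAnnihilator) →ₗ[ℝ] L :=
      { toFun := fun q => ⟨_, lift_mem q.1 q.2⟩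
        map_add' := fun q r => by
          ext1
          simp only [Prod.fst_add, Prod.snd_add, map_add, LinearMap.add_comp, Submodule.coe_add,
            Prod.mk_add_mk, add_add_add_comm]
        map_smul' := fun c q => by
          ext1
          simp only [Prod.smul_fst, Prod.smul_snd, map_smul, LinearMap.smul_comp,
            Submodule.coe_smul, RingHom.id_apply, Prod.smul_mk, smul_add] }
    have hf : Function.Bijective f := by
      constructor
      · rintro ⟨u, β⟩ ⟨v, γ⟩ h
        obtain ⟨h1, h2⟩ := Prod.ext_iff.1 (Subtype.ext_iff.1 h)
        obtain rfl : u = v := Subtype.ext h1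
        obtain rfl : β = γ := Subtype.ext (add_left_cancel h2)
        rfl
      · rintro ⟨⟨u, α⟩, hp⟩
        obtain ⟨hu, hα⟩ := (hL _).1 hp
        refine ⟨(⟨u, hu⟩, ⟨α - (ε ⟨u, hu⟩).comp π, ?_⟩), ?_⟩
        · refine (Submodule.mem_dualAnnihilator _).2 fun e he => ?_
          have hπe := hπ ⟨e, he⟩
          have hαe := hα ⟨e, he⟩
          simp_all
        · exact Subtype.ext (Prod.ext rfl (add_sub_cancel _ _))
    have : Module.Free ℝ E.dualAnnihilator :=
      .of_equiv E.dualQuotEquivDualAnnihilator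
    rw [← (LinearEquiv.ofBijective f hf).finrank_eq, Module.finrank_prod,
      Subspace.finrank_add_finrank_dualAnnihilator_eq]
  · have hmem : p.1 ∈ E := by
      refine (Subspace.forall_mem_dualAnnihilator_apply_eq_zero_iff E p.1).1 fun α hα => ?_
      simpa [hpair] using hL' p hp _ (hle (lift_mem 0 ⟨α, hα⟩))
    refine (hL p).2 ⟨hmem, fun e => ?_⟩
    have h := hL' p hp _ (hle (lift_mem e 0))
    have hπp := hπ ⟨p.1, hmem⟩
    have hskew := halt.neg ⟨p.1, hmem⟩ e
    simp_all
    linarith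
end

section
/- Let V be a finite-dimensional real vector space and L ⊆ V × V* a maximal isotropic subspace for the canonical pairing. Then, with E ⊆ V the image of L under the projection V × V* → V, there exists an alternating bilinear form ε on E such that L = L(E,ε) = {(u,α) : u ∈ E and α(e) = ε(u,e) for all e ∈ E}. -/
/-- A vector which is null and orthogonal to a maximal isotropic subspace for a symmetric bilinear
form lies in that subspace. -/
theorem mem_of_maximal_isotropic {R M : Type*} [CommRing R] [AddCommGroup M] [Module R M]
    (B : M →ₗ[R] M →ₗ[R] R) (hsymm : ∀ x y, B x y = B y x) {L : Submodule R M}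
    (hiso : ∀ x ∈ L, ∀ y ∈ L, B x y = 0)
    (hmax : ∀ L' : Submodule R M, (∀ x ∈ L', ∀ y ∈ L', B x y = 0) → L ≤ L' → L' = L)
    {p : M} (hpp : B p p = 0) (hp : ∀ q ∈ L, B p q = 0) : p ∈ L := by
  have h : L ⊔ Submodule.span R {p} = L := by
    refine hmax _ (fun _ hx₀ _ hy₀ => ?_) le_sup_left
    obtain ⟨x, hx, x', hx', rfl⟩ := Submodule.mem_sup.1 hx₀
    obtain ⟨y, hy, y', hy', rfl⟩ := Submodule.mem_sup.1 hy₀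
    obtain ⟨a, rfl⟩ := Submodule.mem_span_singleton.1 hx'
    obtain ⟨b, rfl⟩ := Submodule.mem_span_singleton.1 hy'
    simp [hiso x hx y hy, hp y hy, hsymm x p, hp x hx, hpp]
  exact h ▸ Submodule.mem_sup_right (Submodule.mem_span_singleton_self p)

/-- The canonical symmetric pairing on `V × V*`, as a bilinear form. -/
def canonicalPairing (R V : Type*) [CommRing R] [AddCommGroup V] [Module R V] :
    (V × Module.Dual R V) →ₗ[R] (V × Module.Dual R V) →ₗ[R] R :=
  LinearMap.mk₂ R (fun x y => x.2 y.1 + y.2 x.1)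
    (fun _ _ _ => by simp; ring) (fun _ _ _ => by simp; ring)
    (fun _ _ _ => by simp; ring) (fun _ _ _ => by simp; ring)

/-- Let `V` be a finite-dimensional real vector space and `L ⊆ V × V*` a maximal isotropic
subspace for the canonical pairing.  Then, with `E ⊆ V` the image of `L` under the
projection `V × V* → V`, there is an alternating bilinear form `ε` on `E` with
`L = L(E,ε)`. -/
theorem stmt_2 (V : Type*) [AddCommGroup V] [Module ℝ V] [FiniteDimensional ℝ V]
    (pairing : (V × Module.Dual ℝ V) → (V × Module.Dual ℝ V) → ℝ)
    (hpair : ∀ x y, pairing x y = x.2 y.1 + y.2 x.1)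
    (L : Submodule ℝ (V × Module.Dual ℝ V))
    (hiso : ∀ x ∈ L, ∀ y ∈ L, pairing x y = 0)
    (hmax : ∀ L' : Submodule ℝ (V × Module.Dual ℝ V),
      (∀ x ∈ L', ∀ y ∈ L', pairing x y = 0) → L ≤ L' → L' = L)
    (E : Submodule ℝ V)
    (hE : E = Submodule.map (LinearMap.fst ℝ V (Module.Dual ℝ V)) L) :
    ∃ ε : E →ₗ[ℝ] E →ₗ[ℝ] ℝ,
      (∀ u : E, ε u u = 0) ∧
      (∀ p : V × Module.Dual ℝ V,
        p ∈ L ↔ ∃ h : p.1 ∈ E, ∀ e : E, p.2 e.1 = ε ⟨p.1, h⟩ e) := by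
  obtain rfl : pairing = fun x y => canonicalPairing ℝ V x y := by
    funext x y
    exact hpair x y
  have hiso' : ∀ x ∈ L, ∀ y ∈ L, x.2 y.1 + y.2 x.1 = 0 := hiso
  have hfst : ∀ x ∈ L, x.1 ∈ E := fun x hx => hE ▸ Submodule.mem_map_of_mem hx
  let π : L →ₗ[ℝ] E := (LinearMap.fst ℝ V (Module.Dual ℝ V)).restrict hfst
  have hπ : Function.Surjective π := by
    rintro ⟨u, hu⟩
    obtain ⟨x, hx, rfl⟩ := Submodule.mem_map.1 (hE ▸ hu)
    exact ⟨⟨x, hx⟩, rfl⟩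
  obtain ⟨s, hs⟩ := π.exists_rightInverse_of_surjective (LinearMap.range_eq_top.2 hπ)
  have hs1 : ∀ u : E, (s u).1.1 = u := fun u => congrArg Subtype.val (LinearMap.congr_fun hs u)
  let ε : E →ₗ[ℝ] E →ₗ[ℝ] ℝ :=
    E.subtype.dualMap ∘ₗ LinearMap.snd ℝ V (Module.Dual ℝ V) ∘ₗ L.subtype ∘ₗ s
  have hε : ∀ u e : E, ε u e = (s u).1.2 e := fun _ _ => rfl
  have halt : ∀ u : E, ε u u = 0 := fun u => by
    have h := hiso' _ (s u).2 _ (s u).2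
    rw [hs1] at h
    rw [hε]
    linarith
  refine ⟨ε, halt, fun p => ⟨fun hp => ⟨hfst p hp, fun e => ?_⟩, ?_⟩⟩
  · have h₁ := hiso' p hp _ (s e).2
    have h₂ := hiso' _ (s ⟨p.1, hfst p hp⟩).2 _ (s e).2
    simp only [hs1] at h₁ h₂
    rw [hε]
    linarith
  · rintro ⟨h, hp⟩
    refine mem_of_maximal_isotropic (canonicalPairing ℝ V) (fun x y => add_comm _ _) hiso hmax
      ?_ fun q hq => ?_
    · change p.2 p.1 + p.2 p.1 = 0
      have h₁ : p.2 p.1 = 0 := (hp ⟨p.1, h⟩).trans (halt _)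
      rw [h₁, add_zero]
    · change p.2 q.1 + q.2 p.1 = 0
      have h₁ := hiso' _ (s ⟨p.1, h⟩).2 q hq
      have h₂ : p.2 q.1 = (s ⟨p.1, h⟩).1.2 q.1 := hp ⟨q.1, hfst q hq⟩
      rw [hs1] at h₁
      rw [h₂, h₁]
end

section
/- Let V be a finite-dimensional real vector space and L ⊆ (V × V*)_ℂ a maximal isotropic subspace for the ℂ-bilinear extension of the canonical pairing with L ∩ σ(L) = {0}, where σ is the conjugation on (V × V*)_ℂ. Then there exists a unique real-linear map 𝒥: V × V* → V × V* with 𝒥² = −id, preserving the canonical pairing, such that the i-eigenspace of 𝒥_ℂ equals L. -/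
open TensorProduct

/-- Over an algebraically closed field of characteristic not two, a maximal isotropic subspace
for a symmetric bilinear form has at least half the dimension of the space, rounded down. -/
theorem finrank_le_of_maximal_isotropic {K E : Type*} [Field K] [IsAlgClosed K] [NeZero (2 : K)]
    [AddCommGroup E] [Module K E] [FiniteDimensional K E] (B : E →ₗ[K] E →ₗ[K] K)
    (hB : ∀ x y, B x y = B y x) (L : Submodule K E) (hiso : ∀ x ∈ L, ∀ y ∈ L, B x y = 0)
    (hmax : ∀ L' : Submodule K E, (∀ x ∈ L', ∀ y ∈ L', B x y = 0) → L ≤ L' → L' = L) :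
    Module.finrank K E ≤ 2 * Module.finrank K L + 1 := by
  by_contra! hlt
  let f : E →ₗ[K] Module.Dual K L := (Submodule.dualRestrict L).comp B
  have hf : ∀ x ∈ LinearMap.ker f, ∀ y ∈ L, B x y = 0 := fun x hx y hy =>
    LinearMap.congr_fun (LinearMap.mem_ker.1 hx) ⟨y, hy⟩
  have mem_of_isotropic : ∀ v ∈ LinearMap.ker f, B v v = 0 → v ∈ L := by
    intro v hv hvv
    have h := hmax (L ⊔ K ∙ v) ?_ le_sup_left
    · exact h ▸ Submodule.mem_sup_right (Submodule.mem_span_singleton_self v)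
    · intro x hx y hy
      obtain ⟨a, ha, b, hb, rfl⟩ := Submodule.mem_sup.1 hx
      obtain ⟨c, hc, d, hd, rfl⟩ := Submodule.mem_sup.1 hy
      obtain ⟨s, rfl⟩ := Submodule.mem_span_singleton.1 hb
      obtain ⟨t, rfl⟩ := Submodule.mem_span_singleton.1 hd
      simp [hiso a ha c hc, hvv, hf v hv c hc, hB a v, hf v hv a ha]
  have hker : Module.finrank K L + 2 ≤ Module.finrank K (LinearMap.ker f) := by
    have h₁ := f.finrank_range_add_finrank_ker
    have h₂ := Submodule.finrank_le (LinearMap.range f)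
    rw [Subspace.dual_finrank_eq] at h₂
    omega
  have exists_notMem : ∀ S : Submodule K E, Module.finrank K S ≤ Module.finrank K L + 1 →
      ∃ x ∈ LinearMap.ker f, x ∉ S := by
    intro S hS
    by_contra! h
    have := Submodule.finrank_mono (show LinearMap.ker f ≤ S from h)
    omega
  obtain ⟨y, hy, hyL⟩ := exists_notMem L (by omega)
  obtain ⟨x, hx, hxL⟩ := exists_notMem (L ⊔ K ∙ y) <|
    (Submodule.finrank_add_le_finrank_add_finrank _ _).trans
      (Nat.add_le_add_left ((finrank_span_le_card {y}).trans (by simp)) _)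
  have hyy : B y y ≠ 0 := fun h => hyL (mem_of_isotropic y hy h)
  obtain ⟨s, hs⟩ := IsAlgClosed.exists_eq_mul_self (discrim (B y y) (2 * B x y) (B x x))
  obtain ⟨t, ht⟩ := exists_quadratic_eq_zero hyy ⟨s, hs⟩
  have hmem : x + t • y ∈ L := by
    refine mem_of_isotropic _ (Submodule.add_mem _ hx (Submodule.smul_mem _ t hy)) ?_
    simp only [map_add, map_smul, LinearMap.add_apply, LinearMap.smul_apply, smul_eq_mul, hB y x]
    linear_combination ht
  refine hxL ?_
  have := Submodule.sub_mem (L ⊔ K ∙ y) (Submodule.mem_sup_left hmem)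
    (Submodule.mem_sup_right (Submodule.smul_mem _ t (Submodule.mem_span_singleton_self y)))
  simpa using this

namespace Complexification

variable {W : Type*} [AddCommGroup W] [Module ℝ W]

/-- The real part of a vector in a complexification. -/
noncomputable def re : ℂ ⊗[ℝ] W →ₗ[ℝ] W :=
  (TensorProduct.lid ℝ W).toLinearMap ∘ₗ Complex.reLm.rTensor W

/-- The imaginary part of a vector in a complexification. -/
noncomputable def im : ℂ ⊗[ℝ] W →ₗ[ℝ] W :=
  (TensorProduct.lid ℝ W).toLinearMap ∘ₗ Complex.imLm.rTensor W

@[simp] theorem re_tmul (a : ℂ) (w : W) : re (a ⊗ₜ[ℝ] w) = a.re • w := by simp [re]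

@[simp] theorem im_tmul (a : ℂ) (w : W) : im (a ⊗ₜ[ℝ] w) = a.im • w := by simp [im]

theorem re_add_im (z : ℂ ⊗[ℝ] W) : (1 : ℂ) ⊗ₜ[ℝ] re z + Complex.I ⊗ₜ[ℝ] im z = z := by
  induction z with
  | zero => simp
  | tmul a w =>
    rw [re_tmul, im_tmul, ← TensorProduct.smul_tmul, ← TensorProduct.smul_tmul,
      ← TensorProduct.add_tmul]
    congr 1
    apply Complex.ext <;> simp
  | add x y hx hy =>
    conv_rhs => rw [← hx, ← hy]
    simp only [map_add, TensorProduct.tmul_add]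
    abel

theorem ext_re_im {z z' : ℂ ⊗[ℝ] W} (hre : re z = re z') (him : im z = im z') : z = z' := by
  rw [← re_add_im z, ← re_add_im z', hre, him]

theorem re_I_smul (z : ℂ ⊗[ℝ] W) : re (Complex.I • z) = -im z := by
  rw [← re_add_im z]
  simp [TensorProduct.smul_tmul']

theorem im_I_smul (z : ℂ ⊗[ℝ] W) : im (Complex.I • z) = re z := by
  rw [← re_add_im z]
  simp [TensorProduct.smul_tmul']

theorem re_baseChange (J : W →ₗ[ℝ] W) (z : ℂ ⊗[ℝ] W) : re (J.baseChange ℂ z) = J (re z) := by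
  rw [← re_add_im z]
  simp

theorem im_baseChange (J : W →ₗ[ℝ] W) (z : ℂ ⊗[ℝ] W) : im (J.baseChange ℂ z) = J (im z) := by
  rw [← re_add_im z]
  simp

theorem mem_eigenspace_I_iff {J : W →ₗ[ℝ] W} (hJ : ∀ w, J (J w) = -w) {z : ℂ ⊗[ℝ] W} :
    z ∈ Module.End.eigenspace (M := ℂ ⊗[ℝ] W) (J.baseChange ℂ) Complex.I ↔ im z = -J (re z) := by
  rw [Module.End.mem_eigenspace_iff]
  constructor
  · intro h
    rw [← re_baseChange, h, re_I_smul, neg_neg]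
  · intro h
    apply ext_re_im
    · rw [re_baseChange, re_I_smul, h, neg_neg]
    · rw [im_baseChange, im_I_smul, h, map_neg, hJ, neg_neg]

/-- If taking real parts is a bijection from a complex subspace `L` onto `W`, then `L` is the
`i`-eigenspace of the complexification of a unique complex structure on `W`. -/
theorem existsUnique_complexStructure (L : Submodule ℂ (ℂ ⊗[ℝ] W))
    (hL : Function.Bijective (re.domRestrict (L.restrictScalars ℝ))) :
    ∃! J : W →ₗ[ℝ] W, (∀ w, J (J w) = -w) ∧
      Module.End.eigenspace (M := ℂ ⊗[ℝ] W) (J.baseChange ℂ) Complex.I = L := by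
  have hinj : ∀ z ∈ L, ∀ z' ∈ L, re z = re z' → z = z' := fun z hz z' hz' h =>
    congrArg Subtype.val (@hL.1 ⟨z, hz⟩ ⟨z', hz'⟩ h)
  have hsurj : ∀ w, ∃ z ∈ L, re z = w := fun w =>
    let ⟨z, hz⟩ := hL.2 w
    ⟨z, z.2, hz⟩
  let e := LinearEquiv.ofBijective _ hL
  let J : W →ₗ[ℝ] W := -(im ∘ₗ (L.restrictScalars ℝ).subtype ∘ₗ e.symm.toLinearMap)
  have hJ : ∀ z ∈ L, J (re z) = -im z := by
    intro z hz
    have : e.symm (re z) = ⟨z, hz⟩ := e.symm_apply_eq.2 rfl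
    simp [J, this]
  have hJJ : ∀ w, J (J w) = -w := by
    intro w
    obtain ⟨z, hz, rfl⟩ := hsurj w
    rw [hJ z hz, ← re_I_smul, hJ _ (L.smul_mem _ hz), im_I_smul]
  refine ⟨J, ⟨hJJ, ?_⟩, ?_⟩
  · ext z
    rw [mem_eigenspace_I_iff hJJ]
    constructor
    · intro h
      obtain ⟨z', hz', hre⟩ := hsurj (re z)
      have : z' = z := ext_re_im hre (by rw [h, ← hre, hJ z' hz', neg_neg])
      exact this ▸ hz'
    · intro hz
      rw [hJ z hz, neg_neg]
  · rintro J' ⟨hJ', hEq⟩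
    ext1 w
    obtain ⟨z, hz, rfl⟩ := hsurj w
    have := (mem_eigenspace_I_iff hJ').1 (hEq.symm ▸ hz)
    rw [hJ z hz, this, neg_neg]

end Complexification

open Complexification

/-- A maximal isotropic subspace `L` of `(V × V*)_ℂ` with `L ∩ σ(L) = {0}` is the
`i`-eigenspace of the complexification of a unique real linear generalized complex
structure `𝒥` on `V × V*`. -/
theorem stmt_8 (V : Type*) [AddCommGroup V] [Module ℝ V] [FiniteDimensional ℝ V]
    (pairing : (V × Module.Dual ℝ V) → (V × Module.Dual ℝ V) → ℝ)
    (hpair : ∀ x y, pairing x y = x.2 y.1 + y.2 x.1)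
    (Pc : TensorProduct ℝ ℂ (V × Module.Dual ℝ V) →ₗ[ℂ]
      TensorProduct ℝ ℂ (V × Module.Dual ℝ V) →ₗ[ℂ] ℂ)
    (hPc : ∀ (a b : ℂ) (x y : V × Module.Dual ℝ V),
      Pc (a ⊗ₜ x) (b ⊗ₜ y) = a * b * (pairing x y : ℂ))
    (σ : TensorProduct ℝ ℂ (V × Module.Dual ℝ V) →ₗ[ℝ]
      TensorProduct ℝ ℂ (V × Module.Dual ℝ V))
    (hσ : ∀ (a : ℂ) (w : V × Module.Dual ℝ V), σ (a ⊗ₜ w) = (starRingEnd ℂ a) ⊗ₜ w)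
    (L : Submodule ℂ (TensorProduct ℝ ℂ (V × Module.Dual ℝ V)))
    (hiso : ∀ x ∈ L, ∀ y ∈ L, Pc x y = 0)
    (hmax : ∀ L' : Submodule ℂ (TensorProduct ℝ ℂ (V × Module.Dual ℝ V)),
      (∀ x ∈ L', ∀ y ∈ L', Pc x y = 0) → L ≤ L' → L' = L)
    (hreal : (L : Set (TensorProduct ℝ ℂ (V × Module.Dual ℝ V))) ∩
      (σ '' (L : Set (TensorProduct ℝ ℂ (V × Module.Dual ℝ V)))) = {0}) :
    ∃! 𝒥 : (V × Module.Dual ℝ V) →ₗ[ℝ] (V × Module.Dual ℝ V),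
      (∀ p, 𝒥 (𝒥 p) = -p) ∧
      (∀ e₁ e₂, pairing (𝒥 e₁) (𝒥 e₂) = pairing e₁ e₂) ∧
      Module.End.eigenspace (M := TensorProduct ℝ ℂ (V × Module.Dual ℝ V)) (𝒥.baseChange ℂ) Complex.I = L := by
  have hsymm : ∀ x y, Pc x y = Pc y x := by
    intro x y
    induction x with
    | zero => simp
    | add x x' hx hx' => simp only [map_add, LinearMap.add_apply, hx, hx']
    | tmul a x =>
      induction y with
      | zero => simp
      | add y y' hy hy' => simp only [map_add, LinearMap.add_apply, hy, hy']
      | tmul b y => rw [hPc, hPc, hpair, hpair, add_comm (x.2 y.1), mul_comm a]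
  have hinj : Function.Injective (re.domRestrict (L.restrictScalars ℝ)) := by
    rw [injective_iff_map_eq_zero]
    rintro ⟨z, hz⟩ hre
    replace hre : re z = 0 := hre
    have hz' : σ (-z) = z := by
      rw [← re_add_im z, hre]
      simp [hσ, TensorProduct.neg_tmul]
    have : z ∈ (L : Set _) ∩ σ '' L := ⟨hz, -z, L.neg_mem hz, hz'⟩
    rw [hreal] at this
    exact Subtype.ext this
  have hdim : Module.finrank ℝ (L.restrictScalars ℝ) =
      Module.finrank ℝ (V × Module.Dual ℝ V) := by
    apply le_antisymm (LinearMap.finrank_le_finrank_of_injective hinj)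
    have h₁ := finrank_le_of_maximal_isotropic Pc hsymm L hiso hmax
    have h₂ : Module.finrank ℝ (L.restrictScalars ℝ) = 2 * Module.finrank ℂ L :=
      finrank_real_of_complex L
    rw [Module.finrank_baseChange] at h₁
    rw [Module.finrank_prod, Subspace.dual_finrank_eq] at h₁ ⊢
    omega
  have hbij : Function.Bijective (re.domRestrict (L.restrictScalars ℝ)) :=
    ⟨hinj, (LinearMap.injective_iff_surjective_of_finrank_eq_finrank hdim).1 hinj⟩
  obtain ⟨J, ⟨hJJ, hJL⟩, huniq⟩ := existsUnique_complexStructure L hbij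
  refine ⟨J, ⟨hJJ, ?_, hJL⟩, fun J' hJ' => huniq J' ⟨hJ'.1, hJ'.2.2⟩⟩
  have hmem : ∀ w, (1 : ℂ) ⊗ₜ[ℝ] w + Complex.I ⊗ₜ[ℝ] (-J w) ∈ L := by
    intro w
    rw [← hJL, mem_eigenspace_I_iff hJJ]
    simp
  intro x y
  have h := congrArg Complex.re (hiso _ (hmem x) _ (hmem y))
  simp only [map_add, LinearMap.add_apply, hPc] at h
  simp [hpair] at h
  rw [hpair, hpair]
  linarith
end

section
/- Let V be a finite-dimensional real vector space, J: V → V with J² = −id, and β: V* → V skew with J ∘ β = β ∘ J*. Define 𝒥: V × V* → V × V* by 𝒥(X,ξ) = (J X + β ξ, −J* ξ). Then the i-eigenspace of the complexification 𝒥_ℂ on V_ℂ × (V*)_ℂ equals {(Y − (i/2) β_ℂ η, η) : Y in the i-eigenspace of J_ℂ, η in the (−i)-eigenspace of (J*)_ℂ}. -/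
open TensorProduct

/-- If `A ∘ B = B ∘ D`, the `i`-eigenvectors `(x, η)` of `(x, η) ↦ (A x + B η, -D η)` are those with
`x + (i/2) B η` an `i`-eigenvector of `A` and `η` a `(-i)`-eigenvector of `D`. -/
theorem eigenvector_triangular_iff {M N : Type*} [AddCommGroup M] [Module ℂ M]
    [AddCommGroup N] [Module ℂ N] (A : M →ₗ[ℂ] M) (B : N →ₗ[ℂ] M) (D : N →ₗ[ℂ] N)
    (hAB : ∀ η, A (B η) = B (D η)) (x : M) (η : N) :
    (A x + B η = Complex.I • x ∧ -D η = Complex.I • η) ↔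
      A (x + (Complex.I / 2) • B η) = Complex.I • (x + (Complex.I / 2) • B η) ∧
        D η = -Complex.I • η := by
  have hD : -D η = Complex.I • η ↔ D η = -Complex.I • η := by
    rw [neg_eq_iff_eq_neg, neg_smul]
  rw [hD]
  refine and_congr_left fun h => ?_
  have hI : Complex.I / 2 * -Complex.I = 1 / 2 := by linear_combination (-1 / 2) * Complex.I_mul_I
  have hI' : Complex.I * (Complex.I / 2) = -1 / 2 := by linear_combination (1 / 2) * Complex.I_mul_I
  rw [map_add, map_smul, hAB, h, map_smul, smul_add, smul_smul, smul_smul, hI, hI',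
    ← sub_eq_zero, ← sub_eq_zero (a := A x + _)]
  refine Eq.congr_left ?_
  module

/-- For `𝒥(X,ξ) = (J X + β ξ, −J*ξ)` with `J² = −id`, `β` skew and `J∘β = β∘J*`, the
`i`-eigenspace of `𝒥_ℂ` is `{(Y − (i/2) β_ℂ η, η) : Y ∈ Eig(J_ℂ, i), η ∈ Eig((J*)_ℂ, −i)}`. -/
theorem stmt_13 (V : Type*) [AddCommGroup V] [Module ℝ V] [FiniteDimensional ℝ V]
    (J : V →ₗ[ℝ] V) (hJ : ∀ v, J (J v) = -v)
    (β : Module.Dual ℝ V →ₗ[ℝ] V)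
    (hβ : ∀ ξ η : Module.Dual ℝ V, η (β ξ) = - ξ (β η))
    (hcomm : ∀ ξ : Module.Dual ℝ V, J (β ξ) = β (J.dualMap ξ))
    (𝒥 : (V × Module.Dual ℝ V) →ₗ[ℝ] (V × Module.Dual ℝ V))
    (h𝒥 : ∀ (X : V) (ξ : Module.Dual ℝ V), 𝒥 (X, ξ) = (J X + β ξ, - J.dualMap ξ))
    (𝒥c : (TensorProduct ℝ ℂ V × TensorProduct ℝ ℂ (Module.Dual ℝ V)) →ₗ[ℂ]
      (TensorProduct ℝ ℂ V × TensorProduct ℝ ℂ (Module.Dual ℝ V)))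
    (h1 : ∀ (a : ℂ) (X : V), 𝒥c (a ⊗ₜ X, 0) = (a ⊗ₜ J X, 0))
    (h2 : ∀ (a : ℂ) (ξ : Module.Dual ℝ V),
      𝒥c (0, a ⊗ₜ ξ) = (a ⊗ₜ β ξ, -(a ⊗ₜ J.dualMap ξ))) :
    ∀ p : TensorProduct ℝ ℂ V × TensorProduct ℝ ℂ (Module.Dual ℝ V),
      p ∈ Module.End.eigenspace
        (M := TensorProduct ℝ ℂ V × TensorProduct ℝ ℂ (Module.Dual ℝ V)) 𝒥c Complex.I ↔
      ∃ Y ∈ Module.End.eigenspace (M := TensorProduct ℝ ℂ V)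
          (J.baseChange ℂ) Complex.I,
        ∃ η ∈ Module.End.eigenspace (M := TensorProduct ℝ ℂ (Module.Dual ℝ V))
          (J.dualMap.baseChange ℂ) (-Complex.I),
          p = (Y - (Complex.I / 2) • (β.baseChange ℂ) η, η) := by
  have hAB : ∀ η, J.baseChange ℂ (β.baseChange ℂ η) = β.baseChange ℂ (J.dualMap.baseChange ℂ η) := by
    intro η
    simp only [← LinearMap.comp_apply, ← LinearMap.baseChange_comp]
    rw [LinearMap.ext hcomm (f := J ∘ₗ β) (g := β ∘ₗ J.dualMap)]
  have hleft : ∀ x, 𝒥c (x, 0) = (J.baseChange ℂ x, 0) := by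
    intro x
    induction x with
    | zero => simp only [map_zero]; exact map_zero 𝒥c
    | tmul a X => simp [h1]
    | add x y hx hy => simpa [hx, hy] using map_add 𝒥c (x, 0) (y, 0)
  have hright : ∀ η, 𝒥c (0, η) = (β.baseChange ℂ η, -J.dualMap.baseChange ℂ η) := by
    intro η
    induction η with
    | zero => simp only [map_zero, neg_zero]; exact map_zero 𝒥c
    | tmul a ξ => simp [h2]
    | add x y hx hy => simpa [hx, hy, add_comm] using map_add 𝒥c (0, x) (0, y)
  rintro ⟨x, η⟩
  have hp : 𝒥c (x, η) = (J.baseChange ℂ x + β.baseChange ℂ η, -J.dualMap.baseChange ℂ η) := by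
    simpa [hleft, hright] using map_add 𝒥c (x, 0) (0, η)
  rw [Module.End.mem_eigenspace_iff, hp, Prod.smul_mk, Prod.mk.injEq,
    eigenvector_triangular_iff _ _ _ hAB]
  simp only [Module.End.mem_eigenspace_iff]
  constructor
  · rintro ⟨hx, hη⟩
    exact ⟨_, hx, η, hη, by rw [add_sub_cancel_right]⟩
  · rintro ⟨Y, hY, η', hη, h⟩
    obtain ⟨rfl, rfl⟩ := Prod.mk.inj h
    rw [sub_add_cancel]
    exact ⟨hY, hη⟩
end
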